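/- arXiv:1709.04960 — 9 statements merged into one kernel-verified Lean document; each statement's English description precedes it below -/
import Mathlib

section
/- Let K ⊆ ℝ^d be a nonempty compact convex set of diameter at most D and let f_1,…,f_T : ℝ^d → ℝ be convex differentiable functions such that 0 < g ≤ ‖∇f_t(x)‖ ≤ G for all x ∈ K and all t; set γ = G/g. Suppose the iterates are generated by projected Online Gradient Descent with step sizes η_t = 1/√t and multiplicatively perturbed gradient feedback, i.e. x_1 ∈ K and x_{t+1} = Π_K(x_t − η_t v_t) where v_t = c_t ∇f_t(x_t) for some scalar c_t ∈ [1/γ, γ]. Then for every x* ∈ K: (i) Σ_{t=1}^T c_t (f_t(x_t) − f_t(x*)) ≤ (D²/2 + γ²G²)·√T; and (ii) if moreover f_t(x_t) ≥ f_t(x*) for every t, then Σ_{t=1}^T (f_t(x_t) − f_t(x*)) ≤ γ·(D²/2 + γ²G²)·√T. -/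
open Finset

lemma aux_grad {E : Type*} [NormedAddCommGroup E] [InnerProductSpace ℝ E] [CompleteSpace E]
    (f : E → ℝ) (hf : ConvexOn ℝ Set.univ f) (hd : Differentiable ℝ f) (x y : E) :
    f x - f y ≤ inner ℝ (gradient f x) (x - y) := by
  have h1 : ConvexOn ℝ Set.univ (fun s : ℝ => f (AffineMap.lineMap x y s)) := by
    have := hf.comp_affineMap (AffineMap.lineMap (k := ℝ) x y)
    simpa [Function.comp_def] using this
  have h2 : HasDerivAt (fun s : ℝ => f (AffineMap.lineMap x y s)) (inner ℝ (gradient f x) (y - x)) 0 := by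
    have hg : HasFDerivAt f (InnerProductSpace.toDual ℝ E (gradient f x))
        (AffineMap.lineMap x y (0 : ℝ)) := by
      rw [AffineMap.lineMap_apply_zero]
      exact (hd x).hasGradientAt.hasFDerivAt
    have := hg.comp_hasDerivAt (0 : ℝ) (AffineMap.hasDerivAt_lineMap (a := x) (b := y) (x := (0 : ℝ)))
    simpa [Function.comp_def] using this
  have h3 := h1.le_slope_of_hasDerivAt (Set.mem_univ (0 : ℝ)) (Set.mem_univ (1 : ℝ)) one_pos h2
  simp only [slope_def_field, AffineMap.lineMap_apply_zero, AffineMap.lineMap_apply_one, sub_zero, div_one] at h3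
  have : inner ℝ (gradient f x) (x - y) = - inner ℝ (gradient f x) (y - x) := by
    rw [← inner_neg_right, neg_sub]
  linarith

lemma aux_proj {E : Type*} [NormedAddCommGroup E] [InnerProductSpace ℝ E]
    (K : Set E) (hK : Convex ℝ K) (y p z : E) (hp : p ∈ K) (hz : z ∈ K)
    (hmin : ∀ w ∈ K, ‖p - y‖ ≤ ‖w - y‖) : ‖p - z‖ ^ 2 ≤ ‖y - z‖ ^ 2 := by
  have : Nonempty K := ⟨⟨p, hp⟩⟩
  have h := (norm_eq_iInf_iff_real_inner_le_zero hK (u := y) hp).1 (by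
    apply le_antisymm
    · refine le_ciInf fun w => ?_
      rw [norm_sub_rev y p, norm_sub_rev y]
      exact hmin w w.2
    · exact ciInf_le (f := fun w : K => ‖y - w‖) ⟨0, by rintro _ ⟨w, rfl⟩; exact norm_nonneg _⟩ ⟨p, hp⟩) z hz
  have e : y - z = (y - p) - (z - p) := by abel
  rw [e, norm_sub_sq_real (y - p), norm_sub_rev p z]
  nlinarith [sq_nonneg ‖y - p‖]

lemma aux_step {E : Type*} [NormedAddCommGroup E] [InnerProductSpace ℝ E]
    (a z v : E) (r : ℝ) (hr : 0 < r) :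
    inner ℝ v (a - z) = r / 2 * (‖a - z‖ ^ 2 - ‖a - (1 / r) • v - z‖ ^ 2) + ‖v‖ ^ 2 / (2 * r) := by
  have e : a - (1 / r) • v - z = (a - z) - (1 / r) • v := by abel
  rw [e, norm_sub_sq_real (a - z), real_inner_smul_right, norm_smul, real_inner_comm, mul_pow]
  simp only [Real.norm_eq_abs, sq_abs]
  field_simp
  ring

/-- Projected Online Gradient Descent with multiplicatively
perturbed gradient feedback on a compact convex set `K ⊆ ℝ^d`. -/
theorem ogd_perturbed_gradient_regret
    (d T : ℕ) (K : Set (EuclideanSpace ℝ (Fin d)))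
    (hKne : K.Nonempty) (hKcpt : IsCompact K) (hKconv : Convex ℝ K)
    (D g G : ℝ) (hg : 0 < g) (hgG : g ≤ G)
    (hdiam : ∀ x ∈ K, ∀ y ∈ K, ‖x - y‖ ≤ D)
    (f : ℕ → EuclideanSpace ℝ (Fin d) → ℝ)
    (hconv : ∀ t, ConvexOn ℝ Set.univ (f t))
    (hdiff : ∀ t, Differentiable ℝ (f t))
    (hgrad : ∀ t ∈ Icc 1 T, ∀ x ∈ K, g ≤ ‖gradient (f t) x‖ ∧ ‖gradient (f t) x‖ ≤ G)
    (γ : ℝ) (hγ : γ = G / g)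
    -- metric projection onto K
    (proj : EuclideanSpace ℝ (Fin d) → EuclideanSpace ℝ (Fin d))
    (hproj : ∀ y, proj y ∈ K ∧ ∀ z ∈ K, ‖proj y - y‖ ≤ ‖z - y‖)
    -- step sizes and perturbed gradient feedback
    (η : ℕ → ℝ) (hη : ∀ t, η t = 1 / Real.sqrt t)
    (c : ℕ → ℝ) (hc : ∀ t ∈ Icc 1 T, c t ∈ Set.Icc (1 / γ) γ)
    (v : ℕ → EuclideanSpace ℝ (Fin d))
    (x : ℕ → EuclideanSpace ℝ (Fin d))
    (hx1 : x 1 ∈ K)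
    (hv : ∀ t ∈ Icc 1 T, v t = c t • gradient (f t) (x t))
    (hupd : ∀ t ∈ Icc 1 T, x (t + 1) = proj (x t - η t • v t))
    (xstar : EuclideanSpace ℝ (Fin d)) (hxstar : xstar ∈ K) :
    (∑ t ∈ Icc 1 T, c t * (f t (x t) - f t xstar) ≤ (D ^ 2 / 2 + γ ^ 2 * G ^ 2) * Real.sqrt T)
    ∧ ((∀ t ∈ Icc 1 T, f t xstar ≤ f t (x t)) →
      ∑ t ∈ Icc 1 T, (f t (x t) - f t xstar) ≤ γ * (D ^ 2 / 2 + γ ^ 2 * G ^ 2) * Real.sqrt T) := by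
  have hγ1 : 1 ≤ γ := by rw [hγ, le_div_iff₀ hg]; linarith
  have hγ0 : 0 < γ := by linarith
  have hxK : ∀ t, t ≤ T → x (t + 1) ∈ K := by
    intro t ht
    rcases Nat.eq_zero_or_pos t with rfl | h
    · simpa using hx1
    · rw [hupd t (mem_Icc.2 ⟨h, ht⟩)]
      exact (hproj _).1
  have key : ∀ n, n ≤ T → ∑ t ∈ Icc 1 n, c t * (f t (x t) - f t xstar)
      + Real.sqrt n / 2 * ‖x (n + 1) - xstar‖ ^ 2 ≤ (D ^ 2 / 2 + γ ^ 2 * G ^ 2) * Real.sqrt n := by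
    intro n
    induction n with
    | zero => intro _; simp
    | succ n ih =>
      intro hn
      have ih := ih (by omega)
      have hm : n + 1 ∈ Icc 1 T := mem_Icc.2 ⟨by omega, hn⟩
      have hxn := hxK n (by omega)
      rw [sum_Icc_succ_top (by omega)]
      have hr : 0 < Real.sqrt ((n + 1 : ℕ) : ℝ) := Real.sqrt_pos.2 (by positivity)
      have hs : 0 ≤ Real.sqrt (n : ℝ) := Real.sqrt_nonneg _
      have hr2 : Real.sqrt ((n + 1 : ℕ) : ℝ) ^ 2 = n + 1 := by
        rw [Real.sq_sqrt (by positivity)]; push_cast; rfl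
      have hs2 : Real.sqrt (n : ℝ) ^ 2 = n := Real.sq_sqrt (by positivity)
      have hst := aux_step (x (n + 1)) xstar (v (n + 1)) _ hr
      have hpr := aux_proj K hKconv (x (n + 1) - η (n + 1) • v (n + 1)) _ xstar
        (hproj _).1 hxstar (hproj _).2
      rw [← hupd _ hm, hη] at hpr
      have hgr := aux_grad (f (n + 1)) (hconv _) (hdiff _) (x (n + 1)) xstar
      obtain ⟨hc1, hc2⟩ := hc _ hm
      have hc0 : 0 ≤ c (n + 1) := le_trans (by positivity) hc1
      have hgr2 := mul_le_mul_of_nonneg_left hgr hc0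
      have hvi : inner ℝ (v (n + 1)) (x (n + 1) - xstar) =
          c (n + 1) * inner ℝ (gradient (f (n + 1)) (x (n + 1))) (x (n + 1) - xstar) := by
        rw [hv _ hm, real_inner_smul_left]
      have hvn : ‖v (n + 1)‖ ^ 2 ≤ γ ^ 2 * G ^ 2 := by
        rw [hv _ hm, norm_smul, mul_pow, Real.norm_eq_abs, sq_abs]
        have := (hgrad _ hm _ hxn).2
        gcongr
      have hD : ‖x (n + 1) - xstar‖ ^ 2 ≤ D ^ 2 := by
        have := hdiam _ hxn _ hxstar
        gcongr
      generalize Real.sqrt ((n + 1 : ℕ) : ℝ) = r at *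
      generalize Real.sqrt (n : ℝ) = s at *
      have hsr : s ≤ r := by
        by_contra! h
        nlinarith
      have hinv : ‖v (n + 1)‖ ^ 2 / (2 * r) ≤ γ ^ 2 * G ^ 2 * (r - s) := by
        rw [div_le_iff₀ (by positivity)]
        have h1 : 1 ≤ (r - s) * (2 * r) := by nlinarith [sq_nonneg (r - s)]
        have h2 : 0 ≤ γ ^ 2 * G ^ 2 := by positivity
        nlinarith
      have h4 := mul_le_mul_of_nonneg_left hpr (by positivity : 0 ≤ r / 2)
      have h5 := mul_le_mul_of_nonneg_left hD (by linarith : 0 ≤ (r - s) / 2)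
      linarith
  have main : ∑ t ∈ Icc 1 T, c t * (f t (x t) - f t xstar)
      ≤ (D ^ 2 / 2 + γ ^ 2 * G ^ 2) * Real.sqrt T := by
    have h := key T le_rfl
    have : 0 ≤ Real.sqrt T / 2 * ‖x (T + 1) - xstar‖ ^ 2 := by positivity
    linarith
  refine ⟨main, fun hpos => ?_⟩
  rw [mul_assoc]
  refine le_trans ?_ (mul_le_mul_of_nonneg_left main hγ0.le)
  rw [mul_sum]
  refine sum_le_sum fun t ht => ?_
  have h1 := (hc t ht).1
  rw [div_le_iff₀ hγ0] at h1
  have h2 := hpos t ht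
  nlinarith
end

section
/- Let I ⊆ ℝ be a closed interval of length at most D (the allowed log-prices) with metric projection Π_I, and let 1 < E_min ≤ E_max. For t = 1,…,T let r̃_t : I → ℝ be a concave log-revenue function such that at every q ∈ I there is a supergradient s_t(q) of r̃_t at q (i.e. r̃_t(q') ≤ r̃_t(q) + s_t(q)(q'−q) for all q' ∈ I) which either equals 1 or lies in the interval [−(E_max−1), −(E_min−1)]. Suppose the seller plays projected gradient ascent with adjusted gradient feedback: p̃_1 ∈ I and p̃_{t+1} = Π_I(p̃_t + η_t g_t) with η_t = 1/√t, where g_t = 1 if s_t(p̃_t) = 1 and g_t = −1 otherwise. Let p̃* ∈ I maximize q ↦ Σ_{t=1}^T r̃_t(q) over I and assume r̃_t(p̃*) ≥ r̃_t(p̃_t) for every t. Then Σ_{t=1}^T (r̃_t(p̃*) − r̃_t(p̃_t)) ≤ max{1, E_max−1}·(D²/2 + 1)·√T. Consequently, if r_t := exp ∘ r̃_t denotes the revenue and r_t ≤ R on I for all t, then Σ_{t=1}^T (r_t(p̃*) − r_t(p̃_t)) ≤ R·max{1, E_max−1}·(D²/2 + 1)·√T. -/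
open Finset

lemma proj_sq_le {a b y q z : ℝ} (hq : q ∈ Set.Icc a b)
    (h : ∀ z ∈ Set.Icc a b, |q - y| ≤ |z - y|) (hz : z ∈ Set.Icc a b) :
    (q - z) ^ 2 ≤ (y - z) ^ 2 := by
  obtain ⟨h1, h2⟩ := hq
  obtain ⟨h3, h4⟩ := hz
  have hab : a ≤ b := h1.trans h2
  rcases lt_or_ge y a with hy | hy
  · have := h a ⟨le_rfl, hab⟩
    rw [abs_of_nonneg (by linarith), abs_of_nonneg (by linarith)] at this
    nlinarith
  · rcases lt_or_ge b y with hy' | hy'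
    · have := h b ⟨hab, le_rfl⟩
      rw [abs_of_nonpos (by linarith), abs_of_nonpos (by linarith)] at this
      nlinarith
    · have := h y ⟨hy, hy'⟩
      simp only [sub_self, abs_zero] at this
      have h0 : q - y = 0 := abs_eq_zero.mp (le_antisymm this (abs_nonneg _))
      have : q = y := by linarith
      rw [this]

/-- Modified OGD (projected gradient ascent with adjusted
`±1` gradient feedback) on log-revenue curves whose supergradients are either
`1` or lie in `[-(E_max - 1), -(E_min - 1)]`. -/
theorem modified_ogd_log_revenue_regret
    (T : ℕ) (a b D R : ℝ) (hab : a ≤ b) (hD : b - a ≤ D)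
    (Emin Emax : ℝ) (hEmin : 1 < Emin) (hE : Emin ≤ Emax)
    (rt : ℕ → ℝ → ℝ)  -- log-revenue functions
    (hconc : ∀ t ∈ Icc 1 T, ConcaveOn ℝ (Set.Icc a b) (rt t))
    (s : ℕ → ℝ → ℝ)  -- supergradients
    (hsup : ∀ t ∈ Icc 1 T, ∀ q ∈ Set.Icc a b, ∀ q' ∈ Set.Icc a b,
      rt t q' ≤ rt t q + s t q * (q' - q))
    (hsval : ∀ t ∈ Icc 1 T, ∀ q ∈ Set.Icc a b,
      s t q = 1 ∨ s t q ∈ Set.Icc (-(Emax - 1)) (-(Emin - 1)))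
    -- metric projection onto the interval
    (proj : ℝ → ℝ)
    (hproj : ∀ y, proj y ∈ Set.Icc a b ∧ ∀ z ∈ Set.Icc a b, |proj y - y| ≤ |z - y|)
    -- iterates of projected gradient ascent with adjusted gradient feedback
    (η : ℕ → ℝ) (hη : ∀ t, η t = 1 / Real.sqrt t)
    (p : ℕ → ℝ) (hp1 : p 1 ∈ Set.Icc a b)
    (gfb : ℕ → ℝ) (hgfb : ∀ t ∈ Icc 1 T, gfb t = if s t (p t) = 1 then 1 else -1)
    (hupd : ∀ t ∈ Icc 1 T, p (t + 1) = proj (p t + η t * gfb t))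
    -- best fixed log-price in hindsight
    (pstar : ℝ) (hpstar : pstar ∈ Set.Icc a b)
    (hopt : ∀ q ∈ Set.Icc a b, ∑ t ∈ Icc 1 T, rt t q ≤ ∑ t ∈ Icc 1 T, rt t pstar)
    (hge : ∀ t ∈ Icc 1 T, rt t (p t) ≤ rt t pstar) :
    (∑ t ∈ Icc 1 T, (rt t pstar - rt t (p t)) ≤
      max 1 (Emax - 1) * (D ^ 2 / 2 + 1) * Real.sqrt T)
    ∧ ((∀ t ∈ Icc 1 T, ∀ q ∈ Set.Icc a b, Real.exp (rt t q) ≤ R) →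
      ∑ t ∈ Icc 1 T, (Real.exp (rt t pstar) - Real.exp (rt t (p t))) ≤
        R * max 1 (Emax - 1) * (D ^ 2 / 2 + 1) * Real.sqrt T) := by
  have hpm : ∀ t ∈ Icc 1 T, p t ∈ Set.Icc a b := by
    intro t ht
    rw [Finset.mem_Icc] at ht
    rcases Nat.lt_or_ge 1 t with h | h
    · obtain ⟨k, rfl⟩ : ∃ k, t = k + 1 := ⟨t - 1, by omega⟩
      rw [hupd k (Finset.mem_Icc.mpr (by omega))]
      exact (hproj _).1
    · have : t = 1 := by omega
      rw [this]; exact hp1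
  have key : ∀ n : ℕ, n ≤ T →
      ∑ t ∈ Icc 1 n, gfb t * (pstar - p t) + Real.sqrt n / 2 * (p (n + 1) - pstar) ^ 2
        ≤ (D ^ 2 / 2 + 1) * Real.sqrt n := by
    intro n
    induction n with
    | zero => intro _; simp
    | succ n ih =>
      intro hn
      have ih := ih (by omega)
      have hm : n + 1 ∈ Icc 1 T := Finset.mem_Icc.mpr (by omega)
      rw [Finset.sum_Icc_succ_top (by omega)]
      have hpn := hpm _ hm
      have hstep : (p (n + 1 + 1) - pstar) ^ 2
          ≤ (p (n + 1) + η (n + 1) * gfb (n + 1) - pstar) ^ 2 := by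
        rw [hupd _ hm]
        exact proj_sq_le (hproj _).1 (hproj _).2 hpstar
      have hg : gfb (n + 1) ^ 2 = 1 := by
        rw [hgfb _ hm]; split_ifs <;> norm_num
      have hd : (p (n + 1) - pstar) ^ 2 ≤ D ^ 2 := by
        obtain ⟨h1, h2⟩ := hpn
        obtain ⟨h3, h4⟩ := hpstar
        exact sq_le_sq' (by linarith) (by linarith)
      have hu0 : 0 ≤ Real.sqrt (n : ℝ) := Real.sqrt_nonneg _
      have hv0 : 0 < Real.sqrt ((n + 1 : ℕ) : ℝ) := Real.sqrt_pos.mpr (by positivity)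
      have hu2 : Real.sqrt (n : ℝ) ^ 2 = n := Real.sq_sqrt (by positivity)
      have hv2 : Real.sqrt ((n + 1 : ℕ) : ℝ) ^ 2 = n + 1 := by
        rw [Real.sq_sqrt (by positivity)]; push_cast; ring
      have hη1 := hη (n + 1)
      generalize Real.sqrt ((n + 1 : ℕ) : ℝ) = v at *
      generalize Real.sqrt (n : ℝ) = u at *
      generalize gfb (n + 1) = g at *
      generalize η (n + 1) = e at *
      generalize p (n + 1 + 1) = y at *
      generalize p (n + 1) = x at *
      generalize ∑ t ∈ Icc 1 n, gfb t * (pstar - p t) = S at *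
      have hev : v * e = 1 := by rw [hη1]; field_simp
      have he0 : 0 ≤ e := by rw [hη1]; positivity
      have huv : u ≤ v := by nlinarith
      have he : e / 2 ≤ v - u := by
        have h1 : (v - u) * (v + u) = 1 := by nlinarith
        have h2 : (v - u) * (2 * v) ≥ 1 := by nlinarith
        have h3 : e * ((v - u) * (2 * v)) ≥ e * 1 := mul_le_mul_of_nonneg_left h2 he0
        have h4 : e * ((v - u) * (2 * v)) = 2 * (v - u) * (v * e) := by ring
        rw [h4, hev] at h3
        linarith
      have h5 : v / 2 * (y - pstar) ^ 2 ≤ v / 2 * (x + e * g - pstar) ^ 2 :=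
        mul_le_mul_of_nonneg_left hstep (by positivity)
      have h6 : v / 2 * (x + e * g - pstar) ^ 2
          = v / 2 * (x - pstar) ^ 2 - g * (pstar - x) + e / 2 := by
        have : v / 2 * (x + e * g - pstar) ^ 2
          = v / 2 * (x - pstar) ^ 2 - (v * e) * g * (pstar - x) + (v * e) * e * g ^ 2 / 2 := by ring
        rw [this, hev, hg]; ring
      have h7 : (v - u) / 2 * (x - pstar) ^ 2 ≤ (v - u) / 2 * D ^ 2 :=
        mul_le_mul_of_nonneg_left hd (by linarith)
      nlinarith
  have hM : (0 : ℝ) ≤ max 1 (Emax - 1) := le_trans zero_le_one (le_max_left _ _)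
  have main : ∑ t ∈ Icc 1 T, (rt t pstar - rt t (p t)) ≤
      max 1 (Emax - 1) * (D ^ 2 / 2 + 1) * Real.sqrt T := by
    have hterm : ∀ t ∈ Icc 1 T, rt t pstar - rt t (p t)
        ≤ max 1 (Emax - 1) * (gfb t * (pstar - p t)) := by
      intro t ht
      have h1 := hsup t ht (p t) (hpm t ht) pstar hpstar
      have h2 := hge t ht
      have hM1 : 1 ≤ max 1 (Emax - 1) := le_max_left _ _
      have hM2 : Emax - 1 ≤ max 1 (Emax - 1) := le_max_right _ _
      rw [hgfb t ht]
      split_ifs with hs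
      · rw [hs] at h1
        nlinarith
      · rcases hsval t ht (p t) (hpm t ht) with h | ⟨h3, h4⟩
        · exact absurd h hs
        · have h5 : pstar - p t ≤ 0 := by
            by_contra hc
            push Not at hc
            nlinarith
          nlinarith
    have hk := key T le_rfl
    have h0 : 0 ≤ Real.sqrt T / 2 * (p (T + 1) - pstar) ^ 2 := by positivity
    calc _ ≤ ∑ t ∈ Icc 1 T, max 1 (Emax - 1) * (gfb t * (pstar - p t)) :=
          Finset.sum_le_sum hterm
      _ = max 1 (Emax - 1) * ∑ t ∈ Icc 1 T, gfb t * (pstar - p t) := by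
          rw [Finset.mul_sum]
      _ ≤ max 1 (Emax - 1) * ((D ^ 2 / 2 + 1) * Real.sqrt T) :=
          mul_le_mul_of_nonneg_left (by linarith) hM
      _ = _ := by ring
  refine ⟨main, fun hR => ?_⟩
  rcases Nat.eq_zero_or_pos T with h0 | hT
  · subst h0; simp
  have hR0 : 0 ≤ R := (Real.exp_pos _).le.trans
    (hR 1 (Finset.mem_Icc.mpr ⟨le_rfl, hT⟩) pstar hpstar)
  calc _ ≤ ∑ t ∈ Icc 1 T, R * (rt t pstar - rt t (p t)) := by
        refine Finset.sum_le_sum fun t ht => ?_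
        have h1 := hR t ht pstar hpstar
        have h2 := hge t ht
        have h3 := Real.add_one_le_exp (rt t (p t) - rt t pstar)
        have h4 : Real.exp (rt t (p t))
            = Real.exp (rt t pstar) * Real.exp (rt t (p t) - rt t pstar) := by
          rw [← Real.exp_add]; congr 1; ring
        have h5 := mul_le_mul_of_nonneg_left h3 (Real.exp_pos (rt t pstar)).le
        have h6 := mul_le_mul_of_nonneg_right h1 (sub_nonneg.mpr h2)
        rw [h4]
        linarith
    _ = R * ∑ t ∈ Icc 1 T, (rt t pstar - rt t (p t)) := by rw [Finset.mul_sum]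
    _ ≤ R * (max 1 (Emax - 1) * (D ^ 2 / 2 + 1) * Real.sqrt T) :=
        mul_le_mul_of_nonneg_left main hR0
    _ = _ := by ring
end

section
/- Let E > 1, w > 0, s > 0 and c ∈ ℝ, and suppose the log-demand along the seller's own log-price is affine: x̃(p̃) = c − E·p̃. Define the log-revenue r̃(p̃) = p̃ + min(x̃(p̃), ln w), let p̃* = (c − ln w)/E (so that x̃(p̃*) = ln w) and let p̃_X = (c − ln w + s)/E (so that x̃(p̃_X) = ln w − s, the log of the threshold demand X = w·e^{−s}). Then p̃* is a global maximizer of r̃, and r̃(p̃*) − r̃(p̃_X) = ((E−1)/E)·s. -/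
/-- For affine iso-elastic log-demand, the price at which
demand equals supply maximizes the log-revenue, and the log-revenue gap between
the optimal price and the threshold price is `((E-1)/E)·s`. -/
theorem log_revenue_threshold_gap
    (E w s c : ℝ) (hE : 1 < E) (hw : 0 < w) (hs : 0 < s)
    (x : ℝ → ℝ) (hx : ∀ p, x p = c - E * p)
    (r : ℝ → ℝ) (hr : ∀ p, r p = p + min (x p) (Real.log w))
    (pstar pX : ℝ)
    (hpstar : pstar = (c - Real.log w) / E)
    (hpX : pX = (c - Real.log w + s) / E) :
    (∀ p, r p ≤ r pstar) ∧ r pstar - r pX = ((E - 1) / E) * s := by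
  have hE0 : E ≠ 0 := by linarith
  have h1 : x pstar = Real.log w := by
    rw [hx, hpstar]; field_simp; ring
  have h2 : x pX = Real.log w - s := by
    rw [hx, hpX]; field_simp; ring
  have h3 : r pstar = pstar + Real.log w := by rw [hr, h1, min_self]
  have h4 : r pX = pX + (Real.log w - s) := by
    rw [hr, h2, min_eq_left (by linarith)]
  refine ⟨fun p => ?_, ?_⟩
  · rw [h3, hr p]
    rcases le_total p pstar with h | h
    · have := min_le_right (x p) (Real.log w)
      linarith
    · have h5 := min_le_left (x p) (Real.log w)
      have h6 := hx p
      have h7 := hx pstar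
      nlinarith [mul_nonneg (sub_nonneg.2 hE.le) (sub_nonneg.2 h)]
  · rw [h3, h4, hpstar, hpX]
    field_simp
    ring
end

section
/- Let E > 1, w > 0, s > 0 and c ∈ ℝ, and suppose the log-demand along the seller's own log-price is affine: x̃(p̃) = c − E·p̃. Define the log-revenue r̃(p̃) = p̃ + min(x̃(p̃), ln w), the smoothed gradient δ(p̃) = min(1, max(1 − E, 1 + E(x̃(p̃) − ln w)/s)), the point p̃_X = (c − ln w + s)/E (where x̃(p̃_X) = ln w − s), and the smoothed log-revenue r̃^{sm}(p̃) = r̃(p̃_X) + ∫_{p̃_X}^{p̃} δ(u) du. Then for every p̃ ∈ ℝ: 0 ≤ r̃(p̃) − r̃^{sm}(p̃) ≤ s. -/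
/-- Cost of smoothing: the smoothed log-revenue (the
antiderivative of the smoothed gradient agreeing with the actual log-revenue at
the threshold price) differs from the actual log-revenue by at most `s`. -/
theorem smoothed_log_revenue_close
    (E w s c : ℝ) (hE : 1 < E) (hw : 0 < w) (hs : 0 < s)
    (x : ℝ → ℝ) (hx : ∀ p, x p = c - E * p)
    (r : ℝ → ℝ) (hr : ∀ p, r p = p + min (x p) (Real.log w))
    (δ : ℝ → ℝ)
    (hδ : ∀ p, δ p = min 1 (max (1 - E) (1 + E * (x p - Real.log w) / s)))
    (pX : ℝ) (hpX : pX = (c - Real.log w + s) / E)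
    (rsm : ℝ → ℝ)
    (hrsm : ∀ p, rsm p = r pX + ∫ u in pX..p, δ u) :
    ∀ p : ℝ, 0 ≤ r p - rsm p ∧ r p - rsm p ≤ s := by
  have hE0 : 0 < E := by linarith
  have hcont : Continuous δ := by
    have h : δ = fun p => min 1 (max (1 - E) (1 + E * ((c - E * p) - Real.log w) / s)) := by
      funext p
      rw [hδ, hx]
    rw [h]
    fun_prop
  have hint : ∀ a b : ℝ, IntervalIntegrable δ MeasureTheory.volume a b :=
    fun a b => hcont.intervalIntegrable a b
  have hEX : E * pX = c - Real.log w + s := by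
    rw [hpX]
    field_simp
  obtain ⟨a, ha⟩ : ∃ a : ℝ, E * a = c - Real.log w :=
    ⟨(c - Real.log w) / E, by field_simp⟩
  have haX : a ≤ pX := by
    by_contra! h
    have := mul_lt_mul_of_pos_left h hE0
    linarith
  have hle1 : ∀ u, δ u ≤ 1 := fun u => by
    rw [hδ]
    exact min_le_left _ _
  have hge : ∀ u, 1 - E ≤ δ u := fun u => by
    rw [hδ]
    exact le_min (by linarith) (le_max_left _ _)
  have hrX : r pX = pX + (c - E * pX) := by
    rw [hr, hx, min_eq_left (by linarith)]
  -- bounds on the integral over an interval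
  have hlo : ∀ p q : ℝ, p ≤ q → (1 - E) * (q - p) ≤ ∫ u in p..q, δ u := by
    intro p q hpq
    have := intervalIntegral.integral_mono_on hpq
      (intervalIntegrable_const (c := 1 - E)) (hint p q) (fun u _ => hge u)
    rw [intervalIntegral.integral_const, smul_eq_mul] at this
    linarith
  have hhi : ∀ p q : ℝ, p ≤ q → ∫ u in p..q, δ u ≤ q - p := by
    intro p q hpq
    have := intervalIntegral.integral_mono_on hpq (hint p q)
      (intervalIntegrable_const (c := (1 : ℝ))) (fun u _ => hle1 u)
    rw [intervalIntegral.integral_const, smul_eq_mul] at this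
    linarith
  have hmid : ∀ p, a ≤ p → r p = p + (c - E * p) := by
    intro p hp
    have := mul_le_mul_of_nonneg_left hp hE0.le
    rw [hr, hx, min_eq_left (by linarith)]
  intro p
  rw [hrsm p]
  rcases le_total pX p with h1 | h1
  · have hc : ∫ u in pX..p, δ u = ∫ u in pX..p, (1 - E) := by
      apply intervalIntegral.integral_congr
      intro u hu
      rw [Set.uIcc_of_le h1] at hu
      have h2 := mul_le_mul_of_nonneg_left hu.1 hE0.le
      have h3 : E * (x u - Real.log w) / s ≤ -E := by
        rw [div_le_iff₀ hs, hx]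
        nlinarith
      show δ u = 1 - E
      rw [hδ, max_eq_left (by linarith), min_eq_right (by linarith)]
    rw [hc, intervalIntegral.integral_const, smul_eq_mul, hmid p (haX.trans h1), hrX]
    constructor <;> nlinarith
  · rcases le_total a p with h2 | h2
    · rw [intervalIntegral.integral_symm, hmid p h2, hrX]
      have h3 := hlo p pX h1
      have h4 := hhi p pX h1
      have h5 := mul_le_mul_of_nonneg_left h2 hE0.le
      constructor <;> nlinarith
    · have hc : ∫ u in p..a, δ u = ∫ u in p..a, (1 : ℝ) := by
        apply intervalIntegral.integral_congr
        intro u hu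
        rw [Set.uIcc_of_le h2] at hu
        have h2 := mul_le_mul_of_nonneg_left hu.2 hE0.le
        have h3 : 0 ≤ E * (x u - Real.log w) / s := by
          apply div_nonneg _ hs.le
          apply mul_nonneg hE0.le
          rw [hx]
          linarith
        show δ u = 1
        rw [hδ, min_eq_left]
        exact le_max_of_le_right (by linarith)
      rw [intervalIntegral.integral_const, smul_eq_mul] at hc
      have hsplit := intervalIntegral.integral_add_adjacent_intervals (hint p a) (hint a pX)
      have h3 := hlo a pX haX
      have h4 := hhi a pX haX
      have h5 := mul_le_mul_of_nonneg_left h2 hE0.le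
      rw [intervalIntegral.integral_symm, ← hsplit, hc, hrX, hr p, hx,
        min_eq_right (by linarith)]
      constructor <;> nlinarith
end

section
/- Fix n, T ∈ ℕ and constants D ≥ 0, ε > 0, r > 0, E > 1; set L = E²/(ε·r) and η = (L·n)^{−1/2}·T^{−1/4}. Consider a seller i with log-price plays p̃_i^1,…,p̃_i^T, which are the i-th coordinates of profiles p̃^1,…,p̃^T ∈ ℝ^n (convention p̃^0 = p̃^1), per-round actual log-revenue functions r̃_t : ℝ → ℝ, smoothed log-revenue functions r̃_t^{sm} : ℝ → ℝ, and gradient signals u^1,…,u^T ∈ ℝ (convention u^0 = u^1). Assume for every round t: (i) u^t is a supergradient of r̃_t^{sm} at p̃_i^t, i.e. r̃_t^{sm}(q) ≤ r̃_t^{sm}(p̃_i^t) + u^t·(q − p̃_i^t) for all q ∈ ℝ; (ii) 0 ≤ r̃_t(q) − r̃_t^{sm}(q) ≤ ε·r for all q ∈ ℝ; (iii) |u^t − u^{t−1}| ≤ L·Σ_{j=1}^n |p̃_j^t − p̃_j^{t−1}| and |p̃_j^t − p̃_j^{t−1}| ≤ 2η for all j; (iv) the RVU inequality with parameters α = D/η,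 β = η: for every q ∈ ℝ, Σ_t u^t·(q − p̃_i^t) ≤ D/η + η·Σ_t |u^t − u^{t−1}|². Let p̃** maximize q ↦ Σ_{t=1}^T r̃_t(q) and assume r̃_t(p̃**) ≥ r for every t. Then Σ_{t=1}^T [(1 − ε)·r̃_t(p̃**) − r̃_t(p̃_i^t)] ≤ (D + 4)·(E²·n/(ε·r))^{1/2}·T^{1/4}. -/
open Finset

/-- OFTRL with smoothed gradient feedback: the loss of a seller
in cumulative log-revenue against a `(1-ε)` fraction of the best fixed log-price
in hindsight is `O(T^{1/4})`. -/
theorem oftrl_smoothed_log_revenue_regret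
    (n T : ℕ) (D ε r E L η : ℝ)
    (hD : 0 ≤ D) (hε : 0 < ε) (hr : 0 < r) (hE : 1 < E)
    (hL : L = E ^ 2 / (ε * r))
    (hη : η = (L * n) ^ (-(1 / 2) : ℝ) * (T : ℝ) ^ (-(1 / 4) : ℝ))
    (p : ℕ → Fin n → ℝ) (i : Fin n) (hp0 : p 0 = p 1)
    (rt : ℕ → ℝ → ℝ)    -- actual log-revenue of seller i per round
    (rsm : ℕ → ℝ → ℝ)   -- smoothed log-revenue of seller i per round
    (u : ℕ → ℝ) (hu0 : u 0 = u 1)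
    -- (i) u^t is a supergradient of the smoothed log-revenue at the play
    (hsup : ∀ t ∈ Icc 1 T, ∀ q : ℝ, rsm t q ≤ rsm t (p t i) + u t * (q - p t i))
    -- (ii) smoothing cost
    (hsm : ∀ t ∈ Icc 1 T, ∀ q : ℝ, 0 ≤ rt t q - rsm t q ∧ rt t q - rsm t q ≤ ε * r)
    -- (iii) Lipschitz gradients and stability
    (hLip : ∀ t ∈ Icc 1 T, |u t - u (t - 1)| ≤ L * ∑ j, |p t j - p (t - 1) j|)
    (hstab : ∀ t ∈ Icc 1 T, ∀ j, |p t j - p (t - 1) j| ≤ 2 * η)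
    -- (iv) RVU inequality with α = D/η, β = η
    (hRVU : ∀ q : ℝ, ∑ t ∈ Icc 1 T, u t * (q - p t i) ≤
      D / η + η * ∑ t ∈ Icc 1 T, |u t - u (t - 1)| ^ 2)
    -- best fixed log-price in hindsight for the actual log-revenue
    (pstar : ℝ)
    (hopt : ∀ q : ℝ, ∑ t ∈ Icc 1 T, rt t q ≤ ∑ t ∈ Icc 1 T, rt t pstar)
    (hlb : ∀ t ∈ Icc 1 T, r ≤ rt t pstar) :
    ∑ t ∈ Icc 1 T, ((1 - ε) * rt t pstar - rt t (p t i)) ≤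
      (D + 4) * Real.sqrt (E ^ 2 * n / (ε * r)) * (T : ℝ) ^ ((1 / 4) : ℝ) := by
  have hn : (0 : ℝ) < n := by
    have : 0 < n := Fin.pos i
    exact_mod_cast this
  have hLpos : 0 < L := by rw [hL]; positivity
  rcases Nat.eq_zero_or_pos T with hT0 | hT
  · subst hT0
    simp
  have hTr : (0 : ℝ) < T := by exact_mod_cast hT
  have hLn : 0 < L * n := by positivity
  set S : ℝ := Real.sqrt (L * n) with hS
  set Q : ℝ := (T : ℝ) ^ ((1 / 4) : ℝ) with hQ
  have hSpos : 0 < S := Real.sqrt_pos.mpr hLn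
  have hQpos : 0 < Q := Real.rpow_pos_of_pos hTr _
  have hS2 : S ^ 2 = L * n := Real.sq_sqrt hLn.le
  have hQ4 : Q ^ 4 = T := by
    rw [hQ, ← Real.rpow_natCast, ← Real.rpow_mul hTr.le]
    norm_num
  have hη' : η = (S * Q)⁻¹ := by
    rw [hη, Real.rpow_neg hLn.le, Real.rpow_neg hTr.le, ← Real.sqrt_eq_rpow, mul_inv]
  have hηpos : 0 < η := by rw [hη']; positivity
  have hSE : Real.sqrt (E ^ 2 * n / (ε * r)) = S := by
    rw [hS, hL]; congr 1; ring
  rw [hSE]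
  have h1 : ∑ t ∈ Icc 1 T, ((1 - ε) * rt t pstar - rt t (p t i)) ≤
      ∑ t ∈ Icc 1 T, u t * (pstar - p t i) := by
    apply Finset.sum_le_sum
    intro t ht
    have a := hsup t ht pstar
    have b := (hsm t ht pstar).2
    have c := (hsm t ht (p t i)).1
    have d := mul_le_mul_of_nonneg_left (hlb t ht) hε.le
    linarith
  have h2 : ∑ t ∈ Icc 1 T, |u t - u (t - 1)| ^ 2 ≤ T * (L * (n * (2 * η))) ^ 2 := by
    have : ∀ t ∈ Icc 1 T, |u t - u (t - 1)| ^ 2 ≤ (L * (n * (2 * η))) ^ 2 := by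
      intro t ht
      have a : ∑ j, |p t j - p (t - 1) j| ≤ n * (2 * η) := by
        have := Finset.sum_le_sum (s := Finset.univ) (fun j _ => hstab t ht j)
        simpa using this
      have b := (hLip t ht).trans (mul_le_mul_of_nonneg_left a hLpos.le)
      exact pow_le_pow_left₀ (abs_nonneg _) b 2
    have := Finset.sum_le_sum this
    simpa using this
  have h3 := mul_le_mul_of_nonneg_left h2 hηpos.le
  have h4 : D / η + η * (T * (L * (n * (2 * η))) ^ 2) = (D + 4) * S * Q := by
    have e : η * (T * (L * (n * (2 * η))) ^ 2) = 4 * η ^ 3 * Q ^ 4 * (S ^ 2) ^ 2 := by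
      rw [hS2, hQ4]; ring
    rw [e, hη']
    field_simp
  linarith [hRVU pstar]
end

section
/- Fix n, T ∈ ℕ and constants D₁, D₂ ≥ 0, L > 0; set η = (L·n)^{−1/2}·T^{−1/4}. Let p^1,…,p^T ∈ ℝ^n be action profiles (convention p^0 = p^1), let u^1,…,u^T ∈ ℝ be a fixed player i's gradient signals (convention u^0 = u^1), and let q_1,…,q_T ∈ ℝ be a benchmark sequence with cumulative variation C_T = Σ_{t=2}^T |q_t − q_{t−1}|. Assume: (DRVU) Σ_{t=1}^T u^t·(q_t − p_i^t) ≤ D₁/η + η·Σ_{t=1}^T |u^t − u^{t−1}|² + (D₂/η)·C_T; (Lipschitz) |u^t − u^{t−1}| ≤ L·Σ_{j=1}^n |p_j^t − p_j^{t−1}| for all t; (stability) |p_j^t − p_j^{t−1}| ≤ 2η for all j and t. Then Σ_{t=1}^T u^t·(q_t − p_i^t) ≤ (D₁ + 4 + D₂·C_T)·(L·n)^{1/2}·T^{1/4}; in particular the dynamic regret of player i is O((1 + C_T)·T^{1/4}). -/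
open Finset

/-- Combining the DRVU property with Lipschitz gradient
signals and stability yields a dynamic regret bound of order `(1 + C_T)·T^{1/4}`. -/
theorem drvu_lipschitz_stability_dynamic_regret
    (n T : ℕ) (D₁ D₂ L η : ℝ) (hD₁ : 0 ≤ D₁) (hD₂ : 0 ≤ D₂) (hL : 0 < L)
    (hη : η = (L * n) ^ (-(1 / 2) : ℝ) * (T : ℝ) ^ (-(1 / 4) : ℝ))
    (p : ℕ → Fin n → ℝ) (u : ℕ → ℝ) (i : Fin n) (q : ℕ → ℝ)
    (hp0 : p 0 = p 1) (hu0 : u 0 = u 1)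
    (CT : ℝ) (hCT : CT = ∑ t ∈ Icc 2 T, |q t - q (t - 1)|)
    (hDRVU : ∑ t ∈ Icc 1 T, u t * (q t - p t i) ≤
      D₁ / η + η * ∑ t ∈ Icc 1 T, |u t - u (t - 1)| ^ 2 + (D₂ / η) * CT)
    (hLip : ∀ t ∈ Icc 1 T, |u t - u (t - 1)| ≤ L * ∑ j, |p t j - p (t - 1) j|)
    (hstab : ∀ t ∈ Icc 1 T, ∀ j, |p t j - p (t - 1) j| ≤ 2 * η) :
    ∑ t ∈ Icc 1 T, u t * (q t - p t i) ≤
      (D₁ + 4 + D₂ * CT) * Real.sqrt (L * n) * (T : ℝ) ^ ((1 / 4) : ℝ) := by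
  rcases Nat.eq_zero_or_pos T with hT | hT
  · subst hT
    simp
  have hn : 0 < n := lt_of_le_of_lt (Nat.zero_le _) i.isLt
  have hnR : (0 : ℝ) < n := by exact_mod_cast hn
  have hTR : (0 : ℝ) < T := by exact_mod_cast hT
  have hLn : 0 < L * n := mul_pos hL hnR
  obtain ⟨a, ha⟩ : ∃ a, a = Real.sqrt (L * n) := ⟨_, rfl⟩
  obtain ⟨b, hb⟩ : ∃ b, b = (T : ℝ) ^ ((1 / 4) : ℝ) := ⟨_, rfl⟩
  have ha0 : 0 < a := by rw [ha]; exact Real.sqrt_pos.mpr hLn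
  have hb0 : 0 < b := by rw [hb]; exact Real.rpow_pos_of_pos hTR _
  have ha2 : a ^ 2 = L * n := by rw [ha]; exact Real.sq_sqrt hLn.le
  have hb4 : b ^ 4 = T := by
    rw [hb, ← Real.rpow_natCast, ← Real.rpow_mul hTR.le]
    norm_num
  have hη' : η = a⁻¹ * b⁻¹ := by
    rw [hη, Real.rpow_neg hLn.le, Real.rpow_neg hTR.le, ← Real.sqrt_eq_rpow, ← ha, ← hb]
  rw [← ha, ← hb]
  have hη0 : 0 < η := by rw [hη']; positivity
  have hterm : ∀ t ∈ Icc 1 T, |u t - u (t - 1)| ^ 2 ≤ (2 * a ^ 2 * η) ^ 2 := by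
    intro t ht
    have h1 : ∑ j, |p t j - p (t - 1) j| ≤ n * (2 * η) := by
      have := Finset.sum_le_sum (s := Finset.univ) (fun j _ => hstab t ht j)
      simpa using this
    have h2 : |u t - u (t - 1)| ≤ 2 * a ^ 2 * η := by
      calc |u t - u (t - 1)| ≤ L * ∑ j, |p t j - p (t - 1) j| := hLip t ht
        _ ≤ L * (n * (2 * η)) := mul_le_mul_of_nonneg_left h1 hL.le
        _ = 2 * a ^ 2 * η := by rw [ha2]; ring
    exact pow_le_pow_left₀ (abs_nonneg _) h2 2
  have hsum : ∑ t ∈ Icc 1 T, |u t - u (t - 1)| ^ 2 ≤ b ^ 4 * (2 * a ^ 2 * η) ^ 2 := by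
    have := Finset.sum_le_sum hterm
    rw [hb4]
    simpa using this
  refine hDRVU.trans ?_
  have h3 := mul_le_mul_of_nonneg_left hsum hη0.le
  have h4 : η * (b ^ 4 * (2 * a ^ 2 * η) ^ 2) = 4 * a * b := by
    rw [hη']; field_simp; norm_num
  have h5 : D₁ / η = D₁ * a * b := by rw [hη']; field_simp
  have h6 : D₂ / η = D₂ * a * b := by rw [hη']; field_simp
  rw [h5, h6]
  rw [h4] at h3
  linarith
end

section
/- Let x : (0,∞)^n → (0,∞)^n be a demand system satisfying gross substitutes (for each good j, x_j(p) is nondecreasing in p_k for every k ≠ j) and homogeneity of degree −1 (x(λp) = λ⁻¹·x(p) for all λ > 0). Let w ∈ (0,∞)^n, ε > 0, fix a good i, and let w' ∈ (0,∞)^n be given by w'_i = (1+ε)·w_i and w'_j = w_j for j ≠ i. Suppose p, p' ∈ (0,∞)^n are equilibrium price vectors: x(p) = w and x(p') = w'. Then for every good j: 1 ≤ p_j/p'_j ≤ 1+ε; that is, when the supply of good i increases by the factor (1+ε), no equilibrium price increases and no equilibrium price decreases by more than the factor (1+ε). -/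
/-- Raising prices of other goods (keeping the price of `j`) does not decrease demand of `j`. -/
lemma gs_mono (n : ℕ) (x : (Fin n → ℝ) → (Fin n → ℝ))
    (hgs : ∀ p : Fin n → ℝ, (∀ j, 0 < p j) → ∀ k j : Fin n, j ≠ k →
      ∀ a b : ℝ, 0 < a → a ≤ b →
        x (Function.update p k a) j ≤ x (Function.update p k b) j)
    (p q : Fin n → ℝ) (hp : ∀ j, 0 < p j) (hpq : ∀ k, p k ≤ q k) (j : Fin n)
    (hj : p j = q j) : x p j ≤ x q j := by
  have key : ∀ s : Finset (Fin n), x p j ≤ x (s.piecewise q p) j := by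
    intro s
    induction s using Finset.induction_on with
    | empty => simp
    | insert k s hk ih =>
      rw [Finset.piecewise_insert]
      have hself : Function.update (s.piecewise q p) k (p k) = s.piecewise q p := by
        have h1 : s.piecewise q p k = p k := by simp [hk]
        rw [← h1, Function.update_eq_self]
      by_cases hjk : j = k
      · subst hjk
        rw [← hj, hself]
        exact ih
      · refine ih.trans ?_
        have hpos : ∀ l, 0 < s.piecewise q p l := by
          intro l
          by_cases hl : l ∈ s
          · simp only [hl, Finset.piecewise_eq_of_mem]
            exact (hp l).trans_le (hpq l)
          · simp [hl, hp l]
        have h := hgs _ hpos k j hjk (p k) (q k) (hp k) (hpq k)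
        rwa [hself] at h
  simpa using key Finset.univ

/-- In a gross substitutes market with degree `-1` homogeneous
demand, increasing the supply of a single good by the factor `1 + ε` does not
increase any equilibrium price and decreases no equilibrium price by more than
the factor `1 + ε`. -/
theorem equilibrium_price_change_supply_increase
    (n : ℕ) (x : (Fin n → ℝ) → (Fin n → ℝ))
    (hpos : ∀ p : Fin n → ℝ, (∀ j, 0 < p j) → ∀ j, 0 < x p j)
    -- gross substitutes: x_j is nondecreasing in p_k for every k ≠ j
    (hgs : ∀ p : Fin n → ℝ, (∀ j, 0 < p j) → ∀ k j : Fin n, j ≠ k →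
      ∀ a b : ℝ, 0 < a → a ≤ b →
        x (Function.update p k a) j ≤ x (Function.update p k b) j)
    -- homogeneity of degree -1
    (hhom : ∀ lam : ℝ, 0 < lam → ∀ p : Fin n → ℝ, (∀ j, 0 < p j) →
      x (lam • p) = lam⁻¹ • x p)
    (w w' : Fin n → ℝ) (hw : ∀ j, 0 < w j) (hw' : ∀ j, 0 < w' j)
    (ε : ℝ) (hε : 0 < ε) (i : Fin n)
    (hwi : w' i = (1 + ε) * w i) (hwj : ∀ j, j ≠ i → w' j = w j)
    (p p' : Fin n → ℝ) (hp : ∀ j, 0 < p j) (hp' : ∀ j, 0 < p' j)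
    (heq : x p = w) (heq' : x p' = w') :
    ∀ j, 1 ≤ p j / p' j ∧ p j / p' j ≤ 1 + ε := by
  intro j₀
  have hne : (Finset.univ : Finset (Fin n)).Nonempty := ⟨i, Finset.mem_univ i⟩
  have hpos' : ∀ j, 0 < p j / p' j := fun j => div_pos (hp j) (hp' j)
  have hww : ∀ j, w j ≤ w' j ∧ w' j ≤ (1 + ε) * w j := by
    intro j
    have := mul_pos hε (hw j)
    by_cases h : j = i
    · subst h
      constructor <;> linarith
    · rw [hwj j h]
      constructor <;> linarith
  have hscale : ∀ r : ℝ, 0 < r → ∀ j, x (r • p') j = r⁻¹ * w' j := by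
    intro r hr j
    rw [hhom r hr p' hp', heq']
    simp
  constructor
  · obtain ⟨j, -, hj⟩ := Finset.exists_min_image Finset.univ (fun j => p j / p' j) hne
    refine le_trans ?_ (hj j₀ (Finset.mem_univ _))
    have h := gs_mono n x hgs ((p j / p' j) • p') p
      (fun k => mul_pos (hpos' j) (hp' k))
      (fun k => (le_div_iff₀ (hp' k)).1 (hj k (Finset.mem_univ _))) j
      (div_mul_cancel₀ _ (hp' j).ne')
    rw [hscale _ (hpos' j), heq, inv_mul_le_iff₀ (hpos' j)] at h
    have h2 := (hww j).1.trans h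
    exact (le_mul_iff_one_le_left (hw j)).1 h2
  · obtain ⟨j, -, hj⟩ := Finset.exists_max_image Finset.univ (fun j => p j / p' j) hne
    refine le_trans (hj j₀ (Finset.mem_univ _)) ?_
    have h := gs_mono n x hgs p ((p j / p' j) • p') hp
      (fun k => (div_le_iff₀ (hp' k)).1 (hj k (Finset.mem_univ _))) j
      (div_mul_cancel₀ _ (hp' j).ne').symm
    rw [hscale _ (hpos' j), heq, le_inv_mul_iff₀ (hpos' j)] at h
    exact le_of_mul_le_mul_right (h.trans (hww j).2) (hw j)
end

section
/- Let x : (0,∞)^n → (0,∞)^n be a demand system satisfying gross substitutes (for each good j, x_j(p) is nondecreasing in p_k for every k ≠ j) and homogeneity of degree −1 (x(λp) = λ⁻¹·x(p) for all λ > 0). Let w ∈ (0,∞)^n, ε > 0, fix a good i, and let w' ∈ (0,∞)^n be given by w'_i = w_i/(1+ε) and w'_j = w_j for j ≠ i. Suppose p, p' ∈ (0,∞)^n are equilibrium price vectors: x(p) = w and x(p') = w'. Then for every good j: 1/(1+ε) ≤ p_j/p'_j ≤ 1; that is, when the supply of good i decreases by the factor (1+ε), no equilibrium price decreases and no equilibrium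 price increases by more than the factor (1+ε). -/
theorem gs_mono_aux (n : ℕ) (x : (Fin n → ℝ) → (Fin n → ℝ))
    (hgs : ∀ p : Fin n → ℝ, (∀ j, 0 < p j) → ∀ k j : Fin n, j ≠ k →
      ∀ a b : ℝ, 0 < a → a ≤ b →
        x (Function.update p k a) j ≤ x (Function.update p k b) j)
    (p r : Fin n → ℝ) (hp : ∀ j, 0 < p j) (hpr : ∀ j, p j ≤ r j)
    (m : Fin n) (hm : p m = r m) : x p m ≤ x r m := by
  have key : ∀ s : Finset (Fin n), x p m ≤ x (s.piecewise r p) m := by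
    intro s
    induction s using Finset.induction_on with
    | empty => simp
    | insert k s hk ih =>
      have hq : ∀ j, 0 < s.piecewise r p j := by
        intro j
        by_cases hj : j ∈ s
        · simpa [hj] using (hp j).trans_le (hpr j)
        · simpa [hj] using hp j
      have hqk : s.piecewise r p k = p k := by simp [hk]
      rw [Finset.piecewise_insert]
      have hupd : Function.update (s.piecewise r p) k (p k) = s.piecewise r p := by
        rw [← hqk, Function.update_eq_self]
      by_cases hmk : m = k
      · subst hmk
        rw [← hm, hupd]
        exact ih
      · have := hgs _ hq k m hmk (p k) (r k) (hp k) (hpr k)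
        rw [hupd] at this
        exact ih.trans this
  simpa using key Finset.univ

theorem gs_ratio_aux (n : ℕ) (x : (Fin n → ℝ) → (Fin n → ℝ))
    (hpos : ∀ p : Fin n → ℝ, (∀ j, 0 < p j) → ∀ j, 0 < x p j)
    (hgs : ∀ p : Fin n → ℝ, (∀ j, 0 < p j) → ∀ k j : Fin n, j ≠ k →
      ∀ a b : ℝ, 0 < a → a ≤ b →
        x (Function.update p k a) j ≤ x (Function.update p k b) j)
    (hhom : ∀ lam : ℝ, 0 < lam → ∀ p : Fin n → ℝ, (∀ j, 0 < p j) →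
      x (lam • p) = lam⁻¹ • x p)
    (p q : Fin n → ℝ) (hp : ∀ j, 0 < p j) (hq : ∀ j, 0 < q j)
    (C : ℝ) (hC : ∀ j, x q j ≤ C * x p j) (j : Fin n) : p j ≤ C * q j := by
  obtain ⟨m, -, hm⟩ := Finset.exists_max_image Finset.univ (fun j => p j / q j)
    ⟨j, Finset.mem_univ j⟩
  have hl : 0 < p m / q m := div_pos (hp m) (hq m)
  have h1 : x p m ≤ x ((p m / q m) • q) m := by
    apply gs_mono_aux n x hgs p _ hp
    · intro k
      have := hm k (Finset.mem_univ k)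
      simpa using (div_le_iff₀ (hq k)).1 this
    · have := (hq m).ne'
      simp [this]
  rw [hhom _ hl q hq, Pi.smul_apply, smul_eq_mul, ← div_eq_inv_mul, le_div_iff₀ hl] at h1
  have h2 : p m / q m ≤ C := by
    have h3 := h1.trans (hC m)
    rw [mul_comm] at h3
    exact le_of_mul_le_mul_right h3 (hpos p hp m)
  exact (div_le_iff₀ (hq j)).1 ((hm j (Finset.mem_univ j)).trans h2)

/-- In a gross substitutes market with degree `-1` homogeneous
demand, decreasing the supply of a single good by the factor `1 + ε` does not
decrease any equilibrium price and increases no equilibrium price by more than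
the factor `1 + ε`. -/
theorem equilibrium_price_change_supply_decrease
    (n : ℕ) (x : (Fin n → ℝ) → (Fin n → ℝ))
    (hpos : ∀ p : Fin n → ℝ, (∀ j, 0 < p j) → ∀ j, 0 < x p j)
    -- gross substitutes: x_j is nondecreasing in p_k for every k ≠ j
    (hgs : ∀ p : Fin n → ℝ, (∀ j, 0 < p j) → ∀ k j : Fin n, j ≠ k →
      ∀ a b : ℝ, 0 < a → a ≤ b →
        x (Function.update p k a) j ≤ x (Function.update p k b) j)
    -- homogeneity of degree -1
    (hhom : ∀ lam : ℝ, 0 < lam → ∀ p : Fin n → ℝ, (∀ j, 0 < p j) →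
      x (lam • p) = lam⁻¹ • x p)
    (w w' : Fin n → ℝ) (hw : ∀ j, 0 < w j) (hw' : ∀ j, 0 < w' j)
    (ε : ℝ) (hε : 0 < ε) (i : Fin n)
    (hwi : w' i = w i / (1 + ε)) (hwj : ∀ j, j ≠ i → w' j = w j)
    (p p' : Fin n → ℝ) (hp : ∀ j, 0 < p j) (hp' : ∀ j, 0 < p' j)
    (heq : x p = w) (heq' : x p' = w') :
    ∀ j, 1 / (1 + ε) ≤ p j / p' j ∧ p j / p' j ≤ 1 := by
  have h1e : 0 < 1 + ε := by linarith
  have key : ∀ k, w' k ≤ w k ∧ w k ≤ (1 + ε) * w' k := by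
    intro k
    by_cases hk : k = i
    · subst hk
      rw [hwi]
      refine ⟨div_le_self (hw k).le (by linarith), ?_⟩
      rw [mul_div_cancel₀ _ h1e.ne']
    · rw [hwj k hk]
      exact ⟨le_rfl, by nlinarith [hw k]⟩
  intro j
  have hA := gs_ratio_aux n x hpos hgs hhom p p' hp hp' 1
    (fun k => by rw [heq, heq', one_mul]; exact (key k).1) j
  have hB := gs_ratio_aux n x hpos hgs hhom p' p hp' hp (1 + ε)
    (fun k => by rw [heq, heq']; exact (key k).2) j
  refine ⟨?_, (div_le_iff₀ (hp' j)).2 hA⟩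
  rw [div_le_div_iff₀ h1e (hp' j)]
  linarith
end

section
/- Fix n, T ∈ ℕ and constants D₁, D₂ ≥ 0, ε > 0, r > 0, E > 1, W_T ≥ 0; set L = E²/(ε·r) and η = (L·n)^{−1/2}·T^{−1/4}. Consider a seller i with log-price plays p̃_i^1,…,p̃_i^T, which are the i-th coordinates of profiles p̃^1,…,p̃^T ∈ ℝ^n (convention p̃^0 = p̃^1), per-round actual log-revenue functions r̃_t : ℝ → ℝ, smoothed log-revenue functions r̃_t^{sm} : ℝ → ℝ, gradient signals u^1,…,u^T ∈ ℝ (convention u^0 = u^1), and a benchmark sequence q_1,…,q_T ∈ ℝ of equilibrium log-prices. Assume for every round t: (i) u^t is a supergradient of r̃_t^{sm} at p̃_i^t, i.e. r̃_t^{sm}(q) ≤ r̃_t^{sm}(p̃_i^t) + u^t·(q − p̃_i^t) for all q ∈ ℝ; (ii) 0 ≤ r̃_t(q) − r̃_t^{sm}(q) ≤ ε·r for all q ∈ ℝ; (iii) |u^t − u^{t−1}| ≤ L·Σ_{j=1}^n |p̃_j^t − p̃_j^{t−1}| and |p̃_j^t − p̃_j^{t−1}| ≤ 2η for all j; (iv)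 the DRVU inequality with parameters α = D₁/η, β = η, ρ = D₂/η: Σ_t u^t·(q_t − p̃_i^t) ≤ D₁/η + η·Σ_t |u^t − u^{t−1}|² + (D₂/η)·Σ_{t=2}^T |q_t − q_{t−1}|; (v) the benchmark variation is bounded by the market instability: Σ_{t=2}^T |q_t − q_{t−1}| ≤ W_T; and (vi) r̃_t(q_t) ≥ r for every t. Then Σ_{t=1}^T [(1 − ε)·r̃_t(q_t) − r̃_t(p̃_i^t)] ≤ (D₁ + 4 + D₂·W_T)·(E²·n/(ε·r))^{1/2}·T^{1/4}. -/
open Finset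

/-- OMD with smoothed gradient feedback in a dynamic market:
the loss of a seller in cumulative log-revenue against a `(1-ε)` fraction of the
per-round equilibrium log-prices is `O((1 + W_T)·T^{1/4})`. -/
theorem omd_smoothed_dynamic_market_regret
    (n T : ℕ) (D₁ D₂ ε r E L η WT : ℝ)
    (hD₁ : 0 ≤ D₁) (hD₂ : 0 ≤ D₂) (hε : 0 < ε) (hr : 0 < r) (hE : 1 < E)
    (hWT : 0 ≤ WT)
    (hL : L = E ^ 2 / (ε * r))
    (hη : η = (L * n) ^ (-(1 / 2) : ℝ) * (T : ℝ) ^ (-(1 / 4) : ℝ))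
    (p : ℕ → Fin n → ℝ) (i : Fin n) (hp0 : p 0 = p 1)
    (rt : ℕ → ℝ → ℝ)    -- actual log-revenue of seller i per round
    (rsm : ℕ → ℝ → ℝ)   -- smoothed log-revenue of seller i per round
    (u : ℕ → ℝ) (hu0 : u 0 = u 1)
    (q : ℕ → ℝ)          -- benchmark sequence of equilibrium log-prices
    -- (i) u^t is a supergradient of the smoothed log-revenue at the play
    (hsup : ∀ t ∈ Icc 1 T, ∀ z : ℝ, rsm t z ≤ rsm t (p t i) + u t * (z - p t i))
    -- (ii) smoothing cost
    (hsm : ∀ t ∈ Icc 1 T, ∀ z : ℝ, 0 ≤ rt t z - rsm t z ∧ rt t z - rsm t z ≤ ε * r)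
    -- (iii) Lipschitz gradients and stability
    (hLip : ∀ t ∈ Icc 1 T, |u t - u (t - 1)| ≤ L * ∑ j, |p t j - p (t - 1) j|)
    (hstab : ∀ t ∈ Icc 1 T, ∀ j, |p t j - p (t - 1) j| ≤ 2 * η)
    -- (iv) DRVU inequality with α = D₁/η, β = η, ρ = D₂/η
    (hDRVU : ∑ t ∈ Icc 1 T, u t * (q t - p t i) ≤
      D₁ / η + η * ∑ t ∈ Icc 1 T, |u t - u (t - 1)| ^ 2
        + (D₂ / η) * ∑ t ∈ Icc 2 T, |q t - q (t - 1)|)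
    -- (v) benchmark variation bounded by the market instability
    (hvar : ∑ t ∈ Icc 2 T, |q t - q (t - 1)| ≤ WT)
    -- (vi) lower bound on the benchmark log-revenue
    (hlb : ∀ t ∈ Icc 1 T, r ≤ rt t (q t)) :
    ∑ t ∈ Icc 1 T, ((1 - ε) * rt t (q t) - rt t (p t i)) ≤
      (D₁ + 4 + D₂ * WT) * Real.sqrt (E ^ 2 * n / (ε * r)) * (T : ℝ) ^ ((1 / 4) : ℝ) := by
  have hstep : ∑ t ∈ Icc 1 T, ((1 - ε) * rt t (q t) - rt t (p t i)) ≤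
      ∑ t ∈ Icc 1 T, u t * (q t - p t i) := by
    apply Finset.sum_le_sum
    intro t ht
    have h1 := hsup t ht (q t)
    have h2 := (hsm t ht (q t)).2
    have h3 := (hsm t ht (p t i)).1
    have h4 := mul_le_mul_of_nonneg_left (hlb t ht) hε.le
    linarith
  rcases Nat.eq_zero_or_pos T with hT | hT
  · subst hT
    simp
  have hTR : (0 : ℝ) < T := by exact_mod_cast hT
  have hn : (0 : ℝ) < n := by
    have : 0 < n := i.pos
    exact_mod_cast this
  have hLpos : 0 < L := by rw [hL]; positivity
  have hLn : 0 < L * n := by positivity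
  have hsq : E ^ 2 * n / (ε * r) = L * n := by rw [hL]; ring
  rw [hsq]
  have ha : 0 < Real.sqrt (L * n) := Real.sqrt_pos.2 hLn
  have ha2 : Real.sqrt (L * n) ^ 2 = L * n := Real.sq_sqrt hLn.le
  have hb : 0 < (T : ℝ) ^ ((1 / 4) : ℝ) := Real.rpow_pos_of_pos hTR _
  have hb4 : ((T : ℝ) ^ ((1 / 4) : ℝ)) ^ 4 = T := by
    rw [← Real.rpow_natCast, ← Real.rpow_mul hTR.le]
    norm_num
  rw [Real.rpow_neg hLn.le, Real.rpow_neg hTR.le, ← Real.sqrt_eq_rpow] at hη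
  generalize Real.sqrt (L * n) = a at *
  generalize (T : ℝ) ^ ((1 / 4) : ℝ) = b at *
  have hdiff : ∀ t ∈ Icc 1 T, |u t - u (t - 1)| ^ 2 ≤ (2 * a / b) ^ 2 := by
    intro t ht
    apply pow_le_pow_left₀ (abs_nonneg _)
    have h1 : ∑ j, |p t j - p (t - 1) j| ≤ ∑ _j : Fin n, 2 * η :=
      Finset.sum_le_sum fun j _ => hstab t ht j
    rw [Finset.sum_const, Finset.card_univ, Fintype.card_fin, nsmul_eq_mul] at h1
    calc |u t - u (t - 1)| ≤ L * (n * (2 * η)) :=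
          (hLip t ht).trans (mul_le_mul_of_nonneg_left h1 hLpos.le)
      _ = 2 * (L * n) * η := by ring
      _ = 2 * a / b := by rw [← ha2, hη]; field_simp
  have hsum := Finset.sum_le_sum hdiff
  rw [Finset.sum_const, Nat.card_Icc, nsmul_eq_mul, Nat.add_sub_cancel, ← hb4] at hsum
  have hηpos : 0 < η := by rw [hη]; positivity
  have h1 := mul_le_mul_of_nonneg_left hsum hηpos.le
  have h2 := mul_le_mul_of_nonneg_left hvar (div_nonneg hD₂ hηpos.le)
  have h3 : D₁ / η + η * (b ^ 4 * (2 * a / b) ^ 2) + D₂ / η * WT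
      = (D₁ + 4 + D₂ * WT) * a * b := by
    rw [hη]; field_simp; ring
  linarith
end
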